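/- Let f : A₂ → A₁ be a homomorphism of commutative rings, and let I₂ ⊆ A₂ and I₁ ⊆ A₁ be ideals with f(I₂) ⊆ I₁ and with I₂ finitely generated. Then the following are equivalent: (i) there exists n ≥ 1 such that (I₂·A₁)ⁿ ⊆ I₁ⁿ⁺¹, where I₂·A₁ denotes the ideal of A₁ generated by f(I₂); (ii) for every a ∈ I₂ there exists m ≥ 1 such that f(a)ᵐ ∈ I₁ᵐ⁺¹. -/

import Mathlib

/-- If `J` and `K` are contracted into `I` by one extra power, then so is `J ⊔ K`. -/
theorem Ideal.sup_pow_add_le_pow_succ {R : Type*} [CommRing R] {I J K : Ideal R} {m k : ℕ}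
    (hJ : J ≤ I) (hK : K ≤ I) (hJm : J ^ m ≤ I ^ (m + 1)) (hKk : K ^ k ≤ I ^ (k + 1)) :
    (J ⊔ K) ^ (m + k) ≤ I ^ (m + k + 1) := by
  have aux {L : Ideal R} {l i : ℕ} (hL : L ≤ I) (hl : L ^ l ≤ I ^ (l + 1)) (hi : l ≤ i) :
      L ^ i ≤ I ^ (i + 1) := by
    obtain ⟨j, rfl⟩ := Nat.exists_eq_add_of_le hi
    rw [pow_add, add_right_comm, pow_add I]
    exact Ideal.mul_mono hl (Ideal.pow_right_mono hL j)
  rw [← Submodule.add_eq_sup, add_pow, Ideal.sum_eq_sup]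
  refine Finset.sup_le fun i hi => Ideal.mul_le_left.trans ?_
  have hi' : i ≤ m + k := Nat.lt_succ_iff.mp (Finset.mem_range.mp hi)
  rcases le_or_gt m i with h | h
  · refine (Ideal.mul_mono (aux hJ hJm h) (Ideal.pow_right_mono hK _)).trans_eq ?_
    rw [← pow_add]
    congr 1
    lia
  · have hk : k ≤ m + k - i := by lia
    refine (Ideal.mul_mono (Ideal.pow_right_mono hJ _) (aux hK hKk hk)).trans_eq ?_
    rw [← pow_add]
    congr 1
    lia

/-- For `f : A₂ → A₁`, ideals `I₂ ⊆ A₂` (finitely generated) and `I₁ ⊆ A₁`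
with `f(I₂) ⊆ I₁`, the uniform contraction condition `∃ n ≥ 1, (I₂·A₁)ⁿ ⊆ I₁ⁿ⁺¹` holds
iff for every `a ∈ I₂` there is `m ≥ 1` with `f(a)ᵐ ∈ I₁ᵐ⁺¹`. -/
theorem stmt8 {A₂ A₁ : Type*} [CommRing A₂] [CommRing A₁]
    (f : A₂ →+* A₁) (I₂ : Ideal A₂) (I₁ : Ideal A₁)
    (hmap : I₂.map f ≤ I₁) (hfg : I₂.FG) :
    (∃ n : ℕ, 1 ≤ n ∧ (I₂.map f) ^ n ≤ I₁ ^ (n + 1)) ↔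
    (∀ a ∈ I₂, ∃ m : ℕ, 1 ≤ m ∧ f a ^ m ∈ I₁ ^ (m + 1)) := by
  constructor
  · rintro ⟨n, hn, h⟩ a ha
    exact ⟨n, hn, h (Ideal.pow_mem_pow (Ideal.mem_map_of_mem f ha) n)⟩
  · intro h
    suffices H : ∀ N : Ideal A₂, N.FG → N ≤ I₂ →
        ∃ n : ℕ, 1 ≤ n ∧ (N.map f) ^ n ≤ I₁ ^ (n + 1) from H I₂ hfg le_rfl
    intro N hN
    induction N, hN using Submodule.fg_induction with
    | singleton a =>
      intro ha
      obtain ⟨m, hm, hmem⟩ := h a (ha (Submodule.mem_span_singleton_self a))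
      refine ⟨m, hm, ?_⟩
      rwa [Ideal.submodule_span_eq, Ideal.map_span, Set.image_singleton,
        Ideal.span_singleton_pow, Ideal.span_singleton_le_iff_mem]
    | sup J K _ _ hJ hK =>
      intro hle
      have hJ' : J ≤ I₂ := le_sup_left.trans hle
      have hK' : K ≤ I₂ := le_sup_right.trans hle
      obtain ⟨m, hm, hJm⟩ := hJ hJ'
      obtain ⟨k, _, hKk⟩ := hK hK'
      refine ⟨m + k, hm.trans (Nat.le_add_right m k), ?_⟩
      rw [Ideal.map_sup]
      exact Ideal.sup_pow_add_le_pow_succ ((Ideal.map_mono hJ').trans hmap)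
        ((Ideal.map_mono hK').trans hmap) hJm hKk
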